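/- arXiv:1911.10703 — 2 statements merged into one kernel-verified Lean document; each statement's English description precedes it below -/
import Mathlib

section
/- Let n ≥ 2 and k ≥ 1 be integers, and let H = PS_{n+1}^{(k)}, a multigraph on vertices {0, 1, …, n+1}. Then the Kostant partition function of H evaluated at the net flow vector that assigns n−1 to vertex 0, −1 to each of the vertices 1, 2, …, n−1, and 0 to vertex n equals |LD_{n−1}(k, 0)|, the number of k-labeled Dyck words of length 2(n−1) containing no letter D_0. -/
/-- The Kostant partition function of a directed multigraph whose edges are
indexed by `E`, with source `src` and target `tgt`: the number of nonnegative
integer flows `b` on the edges such that for every vertex `v` other than the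
last vertex `V`, the net outflow at `v` equals `a v`. -/
noncomputable def kostant {E : Type} [Fintype E] (src tgt : E → ℕ) (V : ℕ) (a : ℕ → ℤ) : ℕ :=
  Nat.card { b : E → ℕ // ∀ v < V,
    ((∑ e : E, if src e = v then (b e : ℤ) else 0) -
     (∑ e : E, if tgt e = v then (b e : ℤ) else 0)) = a v }

/-- Edge index type of `PS_{n+1}^{(k)}`. -/
abbrev PSkEdge (n k : ℕ) : Type := Fin n ⊕ Fin (n - 1) ⊕ Fin k × Fin (n + 1)

def psSrc (n k : ℕ) : PSkEdge n k → ℕ :=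
  Sum.elim (fun i => (i : ℕ) + 1) (Sum.elim (fun i => (i : ℕ) + 1) (fun _ => 0))

def psTgt (n k : ℕ) : PSkEdge n k → ℕ :=
  Sum.elim (fun i => (i : ℕ) + 2) (Sum.elim (fun _ => n + 1) (fun e => (e.2 : ℕ) + 1))

/-- The net flow vector assigning `n-1` to vertex `0`, `-1` to vertices
`1,…,n-1`, and `0` to vertex `n`. -/
def psFlow (n : ℕ) : ℕ → ℤ :=
  fun v => if v = 0 then (n : ℤ) - 1 else if v ≤ n - 1 then -1 else 0

/-- The relation on letters (`none` = `U`, `some i` = `D_i`) requiring that two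
consecutive down-steps have weakly decreasing labels. -/
def DownWeak : Option ℕ → Option ℕ → Prop :=
  fun x y => ∀ a b, x = some a → y = some b → b ≤ a

/-- `w` is a `k`-labeled Dyck word of length `2n`. -/
def IsLDWord (n k : ℕ) (w : List (Option ℕ)) : Prop :=
  w.length = 2 * n ∧ w.count none = n ∧
  (∀ x ∈ w, ∀ i, x = some i → i ≤ k) ∧
  (∀ p : List (Option ℕ), p <+: w → p.length ≤ 2 * p.count none) ∧
  w.Chain' DownWeak

/-- The labels of the weakly decreasing run of down-steps with multiplicities `M`,
where `c : Fin k` stands for the label `c + 1`. -/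
def runLabels {k : ℕ} (M : Multiset (Fin k)) : List ℕ :=
  (M.sort (· ≥ ·)).map fun c : Fin k => (c : ℕ) + 1

/-- The word in which the `i`-th up-step is followed by the run of down-steps given by the
`i`-th entry of the list. -/
def wordOfRuns {k : ℕ} (L : List (Multiset (Fin k))) : List (Option ℕ) :=
  L.flatMap fun M => none :: (runLabels M).map some

/-- Started at height `h`, the path with steps `w` never goes below height `0`. -/
def StaysNonneg (h : ℕ) (w : List (Option ℕ)) : Prop :=
  ∀ p : List (Option ℕ), p <+: w → p.length ≤ 2 * p.count none + h

@[simp]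
lemma wordOfRuns_nil {k : ℕ} : wordOfRuns ([] : List (Multiset (Fin k))) = [] := rfl

@[simp]
lemma wordOfRuns_cons {k : ℕ} (M : Multiset (Fin k)) (L : List (Multiset (Fin k))) :
    wordOfRuns (M :: L) = none :: ((runLabels M).map some ++ wordOfRuns L) := rfl

@[simp]
lemma length_runLabels {k : ℕ} (M : Multiset (Fin k)) : (runLabels M).length = M.card := by
  simp [runLabels]

@[simp]
lemma runLabels_zero {k : ℕ} : runLabels (0 : Multiset (Fin k)) = [] := by
  simp [← List.length_eq_zero_iff]

lemma runLabels_injective {k : ℕ} : Function.Injective (runLabels (k := k)) := by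
  intro M M' h
  have hinj : Function.Injective fun c : Fin k => (c : ℕ) + 1 := fun a b hab => by
    ext; simpa using hab
  have := List.map_injective_iff.2 hinj h
  rw [← Multiset.sort_eq M (· ≥ ·), this, Multiset.sort_eq]

lemma mem_runLabels {k : ℕ} {M : Multiset (Fin k)} {i : ℕ} (h : i ∈ runLabels M) :
    1 ≤ i ∧ i ≤ k := by
  obtain ⟨c, -, rfl⟩ := List.mem_map.1 h
  have := c.2
  omega

lemma mem_wordOfRuns {k : ℕ} {L : List (Multiset (Fin k))} {i : ℕ}
    (h : some i ∈ wordOfRuns L) : 1 ≤ i ∧ i ≤ k := by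
  simp only [wordOfRuns, List.mem_flatMap, List.mem_cons, reduceCtorEq, List.mem_map,
    Option.some.injEq, exists_eq_right, false_or] at h
  obtain ⟨M, -, h⟩ := h
  exact mem_runLabels h

lemma count_none_wordOfRuns {k : ℕ} (L : List (Multiset (Fin k))) :
    (wordOfRuns L).count none = L.length := by
  induction L with
  | nil => rfl
  | cons M L ih =>
    have : ((runLabels M).map some).count none = 0 := by simp [List.count_eq_zero]
    simp [ih, this]

lemma length_wordOfRuns {k : ℕ} (L : List (Multiset (Fin k))) :
    (wordOfRuns L).length = L.length + (L.map Multiset.card).sum := by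
  induction L with
  | nil => rfl
  | cons M L ih => simp [ih]; omega

lemma isChain_wordOfRuns {k : ℕ} (L : List (Multiset (Fin k))) :
    (wordOfRuns L).IsChain DownWeak := by
  induction L with
  | nil => simp
  | cons M L ih =>
    rw [wordOfRuns_cons, List.isChain_cons]
    refine ⟨by simp [DownWeak], List.isChain_append.2 ⟨?_, ih, ?_⟩⟩
    · rw [List.isChain_map, runLabels, List.isChain_map]
      refine ((Multiset.pairwise_sort M (· ≥ ·)).imp ?_).isChain
      rintro a b hab _ _ ⟨⟩ ⟨⟩
      simpa using hab
    · cases L <;> simp [DownWeak]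

lemma map_some_append_wordOfRuns_inj {k : ℕ} {D D' : List ℕ} {L L' : List (Multiset (Fin k))}
    (h : D.map some ++ wordOfRuns L = D'.map some ++ wordOfRuns L') :
    D = D' ∧ wordOfRuns L = wordOfRuns L' := by
  induction D generalizing D' with
  | nil =>
    cases D' with
    | nil => simpa using h
    | cons a D' => cases L <;> simp at h
  | cons a D ih =>
    cases D' with
    | nil => cases L' <;> simp at h
    | cons b D' =>
      simp only [List.map_cons, List.cons_append, List.cons.injEq, Option.some.injEq] at h
      obtain ⟨rfl, h⟩ := h
      simpa using ih h

lemma wordOfRuns_injective {k : ℕ} : Function.Injective (wordOfRuns (k := k)) := by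
  intro L
  induction L with
  | nil => intro L' h; cases L' <;> simp at h ⊢
  | cons M L ih =>
    intro L' h
    cases L' with
    | nil => simp at h
    | cons M' L' =>
      simp only [wordOfRuns_cons, List.cons.injEq, true_and] at h
      obtain ⟨h₁, h₂⟩ := map_some_append_wordOfRuns_inj h
      rw [runLabels_injective h₁, ih h₂]

lemma exists_runs {k : ℕ} (w : List (Option ℕ)) (hlab : ∀ i, some i ∈ w → 1 ≤ i ∧ i ≤ k)
    (hw : w.IsChain DownWeak) :
    ∃ (M : Multiset (Fin k)) (L : List (Multiset (Fin k))),
      w = (runLabels M).map some ++ wordOfRuns L := by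
  induction w with
  | nil => exact ⟨0, [], by simp⟩
  | cons x w ih =>
    obtain ⟨hx, hw⟩ := List.isChain_cons.1 hw
    obtain ⟨M, L, rfl⟩ := ih (fun i hi => hlab i (List.mem_cons_of_mem _ hi)) hw
    cases x with
    | none => exact ⟨0, M :: L, by simp⟩
    | some i =>
      obtain ⟨hi₁, hi₂⟩ := hlab i (by simp)
      obtain ⟨c, rfl⟩ : ∃ c : Fin k, i = c + 1 := ⟨⟨i - 1, by omega⟩, by simp; omega⟩
      refine ⟨c ::ₘ M, L, ?_⟩
      have hM : ∀ b ∈ M, c ≥ b := by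
        intro b hb
        have hs := Multiset.pairwise_sort M (· ≥ ·)
        rw [← Multiset.mem_sort (· ≥ ·)] at hb
        rw [runLabels] at hx
        cases hl : M.sort (· ≥ ·) with
        | nil => simp [hl] at hb
        | cons a l =>
          rw [hl] at hx hb hs
          have hac : a ≤ c := by
            have := hx (some (a + 1)) (by simp) _ _ rfl rfl
            simpa using this
          rcases List.mem_cons.1 hb with rfl | hb
          · exact hac
          · exact ((List.pairwise_cons.1 hs).1 b hb).le.trans hac
      simp [runLabels, Multiset.sort_cons c M (· ≥ ·) hM]

lemma staysNonneg_none_cons {h : ℕ} {w : List (Option ℕ)} :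
    StaysNonneg h (none :: w) ↔ StaysNonneg (h + 1) w := by
  constructor
  · intro H p hp
    have := H (none :: p) (by simpa using hp)
    simp at this
    omega
  · intro H p hp
    rcases List.prefix_cons_iff.1 hp with rfl | ⟨t, rfl, ht⟩
    · simp
    · have := H t ht
      simp
      omega

lemma staysNonneg_some_cons {h i : ℕ} {w : List (Option ℕ)} :
    StaysNonneg h (some i :: w) ↔ 1 ≤ h ∧ StaysNonneg (h - 1) w := by
  constructor
  · intro H
    have h₁ : 1 ≤ h := by simpa using H [some i] (by simp)
    refine ⟨h₁, fun p hp => ?_⟩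
    have := H (some i :: p) (by simpa using hp)
    simp at this
    omega
  · rintro ⟨h₁, H⟩ p hp
    rcases List.prefix_cons_iff.1 hp with rfl | ⟨t, rfl, ht⟩
    · simp
    · have := H t ht
      simp
      omega

lemma staysNonneg_map_some_append {h : ℕ} {D : List ℕ} {w : List (Option ℕ)} :
    StaysNonneg h (D.map some ++ w) ↔ D.length ≤ h ∧ StaysNonneg (h - D.length) w := by
  induction D generalizing h with
  | nil => simp
  | cons a D ih =>
    rw [List.map_cons, List.cons_append, staysNonneg_some_cons, ih, ← and_assoc, List.length_cons,
      Nat.sub_sub, add_comm 1]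
    exact and_congr_left fun _ => by omega

lemma staysNonneg_wordOfRuns {k h : ℕ} {L : List (Multiset (Fin k))} :
    StaysNonneg h (wordOfRuns L) ↔ ∀ j, ((L.take j).map Multiset.card).sum ≤ h + j := by
  induction L generalizing h with
  | nil => simp [StaysNonneg]
  | cons M L ih =>
    rw [wordOfRuns_cons, staysNonneg_none_cons, staysNonneg_map_some_append, ih, length_runLabels]
    constructor
    · rintro ⟨h₁, H⟩ (_ | j)
      · simp
      · have := H j
        simp
        simp at this
        omega
    · intro H
      have h₁ := H 1
      simp at h₁
      refine ⟨h₁, fun j => ?_⟩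
      have := H (j + 1)
      simp at this ⊢
      omega

lemma isLDWord_iff_exists_runs {N k : ℕ} {w : List (Option ℕ)} :
    (IsLDWord N k w ∧ w.count (some 0) = 0) ↔
      ∃ L : List (Multiset (Fin k)), wordOfRuns L = w ∧ L.length = N ∧
        (L.map Multiset.card).sum = N ∧ ∀ j, ((L.take j).map Multiset.card).sum ≤ j := by
  constructor
  · rintro ⟨⟨hlen, hcount, hlab, hpre, hchain⟩, h0⟩
    obtain ⟨M, L, rfl⟩ := exists_runs (k := k) w (fun i hi => ⟨by
      rw [List.count_eq_zero] at h0
      exact Nat.one_le_iff_ne_zero.2 fun h => h0 (h ▸ hi), hlab _ hi i rfl⟩) hchain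
    obtain ⟨hM, hL⟩ : _ ∧ StaysNonneg _ (wordOfRuns L) :=
      staysNonneg_map_some_append.1 (show StaysNonneg 0 _ from hpre)
    obtain rfl : M = 0 := by simpa using hM
    simp only [runLabels_zero, List.map_nil, List.nil_append, List.length_nil] at *
    rw [count_none_wordOfRuns] at hcount
    rw [length_wordOfRuns] at hlen
    refine ⟨L, rfl, hcount, by omega, ?_⟩
    simpa using staysNonneg_wordOfRuns.1 hL
  · rintro ⟨L, rfl, hlen, hsum, hpre⟩
    refine ⟨⟨?_, ?_, ?_, ?_, isChain_wordOfRuns L⟩, ?_⟩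
    · rw [length_wordOfRuns]; omega
    · rw [count_none_wordOfRuns, hlen]
    · rintro _ hx i rfl
      exact (mem_wordOfRuns hx).2
    · exact staysNonneg_wordOfRuns (h := 0).2 (by simpa using hpre)
    · rw [List.count_eq_zero]
      intro h
      simpa using (mem_wordOfRuns h).1

/-- Multiplicities `f i c`, with total sum `N`, whose first `j` rows sum to at least `j`. -/
def IsDominant {N k : ℕ} (f : Fin N → Fin k → ℕ) : Prop :=
  ∑ i, ∑ c, f i c = N ∧ ∀ j ≤ N, j ≤ ∑ i : Fin N with i.val < j, ∑ c, f i c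

/-- Multisets on `Fin k` are the same as multiplicity functions. -/
noncomputable def multisetEquivFun (k : ℕ) : Multiset (Fin k) ≃ (Fin k → ℕ) :=
  Multiset.toFinsupp.toEquiv.trans Finsupp.equivFunOnFinite

lemma sum_multisetEquivFun {k : ℕ} (M : Multiset (Fin k)) :
    ∑ c, multisetEquivFun k M c = M.card := by
  rw [← Multiset.sum_count_eq_card (s := Finset.univ) (fun _ _ => Finset.mem_univ _)]
  rfl

lemma sum_filter_lt_rev_add {N : ℕ} (g : Fin N → ℕ) (j : ℕ) :
    (∑ i : Fin N with i.val < j, g i.rev) + ∑ i : Fin N with i.val < N - j, g i =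
      ∑ i, g i := by
  rw [← Finset.sum_filter_add_sum_filter_not Finset.univ (fun i : Fin N => (i : ℕ) < N - j) g,
    add_comm]
  congr 1
  refine Finset.sum_nbij' Fin.rev Fin.rev ?_ ?_ ?_ ?_ ?_ <;> simp <;> intros <;> omega

lemma isDominant_iff {N k : ℕ} (M : Fin N → Multiset (Fin k)) :
    IsDominant (fun i => multisetEquivFun k (M i.rev)) ↔
      ((List.ofFn M).map Multiset.card).sum = N ∧
        ∀ j, (((List.ofFn M).take j).map Multiset.card).sum ≤ j := by
  have hrev : ∑ i : Fin N, (M i.rev).card = ∑ i, (M i).card :=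
    Equiv.sum_comp Fin.revPerm fun i => (M i).card
  simp only [IsDominant, sum_multisetEquivFun, hrev, List.map_take, List.map_ofFn,
    List.sum_take_ofFn, List.sum_ofFn, Function.comp_apply]
  refine and_congr_right fun htot => ⟨fun H j => ?_, fun H j hj => ?_⟩
  · have h₁ := sum_filter_lt_rev_add (fun i : Fin N => (M i.rev).card) j
    have h₂ := H (N - j) (Nat.sub_le _ _)
    simp only [Fin.rev_rev] at h₁
    omega
  · have h₁ := sum_filter_lt_rev_add (fun i : Fin N => (M i.rev).card) (N - j)
    have h₂ := H (N - j)
    simp only [Fin.rev_rev, Nat.sub_sub_self hj] at h₁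
    omega

lemma card_dominant_eq_card_words (N k : ℕ) :
    Nat.card {f : Fin N → Fin k → ℕ // IsDominant f} =
      Nat.card {w : List (Option ℕ) // IsLDWord N k w ∧ w.count (some 0) = 0} := by
  let e : (Fin N → Fin k → ℕ) ≃ (Fin N → Multiset (Fin k)) :=
    (Equiv.piCongrRight fun _ => (multisetEquivFun k).symm).trans (Fin.revPerm.arrowCongr (.refl _))
  have he (f) : (fun i => multisetEquivFun k (e f i.rev)) = f := by
    ext i c; simp [e, Equiv.arrowCongr]
  have hdom (f) : IsDominant f ↔ ((List.ofFn (e f)).map Multiset.card).sum = N ∧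
      ∀ j, (((List.ofFn (e f)).take j).map Multiset.card).sum ≤ j := by
    rw [← isDominant_iff, he]
  refine Nat.card_congr (Equiv.ofBijective (fun f => ⟨wordOfRuns (List.ofFn (e f.1)),
    isLDWord_iff_exists_runs.2 ⟨_, rfl, by simp, (hdom _).1 f.2⟩⟩) ⟨?_, ?_⟩)
  · rintro ⟨f, hf⟩ ⟨g, hg⟩ h
    simpa using e.injective (List.ofFn_injective (wordOfRuns_injective (Subtype.ext_iff.1 h)))
  · rintro ⟨w, hw⟩
    obtain ⟨L, rfl, rfl, hL⟩ := isLDWord_iff_exists_runs.1 hw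
    have hget : List.ofFn (e (e.symm L.get)) = L := by simp
    exact ⟨⟨e.symm L.get, (hdom _).2 (by rwa [hget])⟩, Subtype.ext (by simp only [hget])⟩

/-- The extension of `g : Fin m → ℕ` by zero to a function `ℕ → ℤ`. -/
def extendZero {m : ℕ} (g : Fin m → ℕ) (u : ℕ) : ℤ :=
  if h : u < m then g ⟨u, h⟩ else 0

lemma extendZero_nonneg {m : ℕ} (g : Fin m → ℕ) (u : ℕ) : 0 ≤ extendZero g u := by
  unfold extendZero; split <;> simp

lemma extendZero_val {m : ℕ} (g : Fin m → ℕ) (i : Fin m) : extendZero g i = g i := by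
  simp [extendZero]

lemma extendZero_of_lt {m : ℕ} (g : Fin m → ℕ) {u : ℕ} (h : u < m) :
    extendZero g u = g ⟨u, h⟩ := by
  simp [extendZero, h]

lemma extendZero_of_le {m : ℕ} (g : Fin m → ℕ) {u : ℕ} (h : m ≤ u) :
    extendZero g u = 0 := by
  simp [extendZero, h]

lemma sum_ite_val_eq {m : ℕ} (g : Fin m → ℕ) (u : ℕ) :
    ∑ i : Fin m, (if (i : ℕ) = u then (g i : ℤ) else 0) = extendZero g u := by
  unfold extendZero
  split_ifs with h
  · rw [Finset.sum_eq_single ⟨u, h⟩] <;> simp +contextual [Fin.ext_iff]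
  · exact Finset.sum_eq_zero fun i _ => if_neg fun hi : (i : ℕ) = u => h (hi ▸ i.2)

lemma sum_range_extendZero {m : ℕ} (g : Fin m → ℕ) (j : ℕ) (hj : j ≤ m) :
    ∑ u ∈ Finset.range j, extendZero g u = ((∑ i : Fin m with i.val < j, g i : ℕ) : ℤ) := by
  push_cast
  symm
  refine Finset.sum_bij (fun i _ => (i : ℕ)) ?_ ?_ ?_ ?_
  · simp
  · simp [Fin.ext_iff]
  · intro u hu
    rw [Finset.mem_range] at hu
    exact ⟨⟨u, by omega⟩, by simpa using hu, rfl⟩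
  · intro i _
    rw [extendZero_val]

/-- Flow on the path edges. -/
def pathFlow {n k : ℕ} (b : PSkEdge n k → ℕ) : ℕ → ℤ := extendZero fun i => b (.inl i)

/-- Flow on the edges from a vertex of the path to the sink. -/
def sinkFlow {n k : ℕ} (b : PSkEdge n k → ℕ) : ℕ → ℤ := extendZero fun i => b (.inr (.inl i))

/-- Total flow from the source `0` to the vertices of the path. -/
def sourceFlow {n k : ℕ} (b : PSkEdge n k → ℕ) : ℕ → ℤ :=
  extendZero fun i => ∑ c, b (.inr (.inr (c, i)))

lemma isFlow_iff {N k : ℕ} (b : PSkEdge (N + 1) k → ℕ) :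
    (∀ v < N + 1 + 1, ((∑ e, if psSrc (N + 1) k e = v then (b e : ℤ) else 0) -
      (∑ e, if psTgt (N + 1) k e = v then (b e : ℤ) else 0)) = psFlow (N + 1) v) ↔
    ∑ u ∈ Finset.range (N + 2), sourceFlow b u = N ∧
      ∀ u ≤ N, pathFlow b u + sinkFlow b u =
        (if u = 0 then 0 else pathFlow b (u - 1)) + sourceFlow b u - if u < N then 1 else 0 := by
  have hout (u : ℕ) : (∑ e, if psSrc (N + 1) k e = u + 1 then (b e : ℤ) else 0) =
      pathFlow b u + sinkFlow b u := by
    simp [psSrc, pathFlow, sinkFlow, ← sum_ite_val_eq]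
  have hin (u : ℕ) (hu : u ≤ N) : (∑ e, if psTgt (N + 1) k e = u + 1 then (b e : ℤ) else 0) =
      (if u = 0 then 0 else pathFlow b (u - 1)) + sourceFlow b u := by
    rcases u with _ | u
    · simp [psTgt, sourceFlow, ← sum_ite_val_eq, Fintype.sum_prod_type]
    · have : N ≠ u := by omega
      simp [psTgt, sourceFlow, pathFlow, ← sum_ite_val_eq, Fintype.sum_prod_type, this]
      rw [Finset.sum_comm]
      refine Finset.sum_congr rfl fun i _ => ?_
      split_ifs <;> simp
  have hzero : (∑ e, if psSrc (N + 1) k e = 0 then (b e : ℤ) else 0) -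
      (∑ e, if psTgt (N + 1) k e = 0 then (b e : ℤ) else 0) =
      ∑ u ∈ Finset.range (N + 2), sourceFlow b u := by
    rw [sourceFlow, sum_range_extendZero _ _ le_rfl]
    simp [psSrc, psTgt, Fintype.sum_prod_type]
    exact Finset.sum_comm
  constructor
  · intro H
    refine ⟨by rw [← hzero, H 0 (by omega)]; simp [psFlow], fun u hu => ?_⟩
    have := H (u + 1) (by omega)
    rw [hout, hin u hu] at this
    simp only [psFlow] at this
    split_ifs at * <;> omega
  · rintro ⟨H₀, H⟩ (_ | u) hv
    · rw [hzero, H₀]; simp [psFlow]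
    · have := H u (by omega)
      rw [hout, hin u (by omega)]
      simp only [psFlow]
      split_ifs at * <;> omega

lemma flow_eq_of_conservation {N : ℕ} {X Y S : ℕ → ℤ} (hX : ∀ u, 0 ≤ X u) (hY : ∀ u, 0 ≤ Y u)
    (hS : ∀ u, 0 ≤ S u) (htot : ∑ u ∈ Finset.range (N + 2), S u = N)
    (H : ∀ u ≤ N, X u + Y u =
        (if u = 0 then 0 else X (u - 1)) + S u - if u < N then 1 else 0) :
    S N = 0 ∧ S (N + 1) = 0 ∧ (∀ u ≤ N, Y u = 0) ∧ X N = 0 ∧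
      ∀ u < N, X u = ∑ i ∈ Finset.range (u + 1), S i - (u + 1) := by
  have key : ∀ u ≤ N, ∑ i ∈ Finset.range u, S i =
      (if u = 0 then 0 else X (u - 1)) + ∑ i ∈ Finset.range u, Y i + u := by
    intro u
    induction u with
    | zero => simp
    | succ u ih =>
      intro hu
      have h₁ := ih (by omega)
      have h₂ := H u (by omega)
      rw [Finset.sum_range_succ, Finset.sum_range_succ, h₁]
      rw [if_pos (show u < N by omega)] at h₂
      simp
      linarith
  have hYsum (u : ℕ) : 0 ≤ ∑ i ∈ Finset.range u, Y i := Finset.sum_nonneg fun i _ => hY i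
  have hprev : 0 ≤ if N = 0 then 0 else X (N - 1) := by split_ifs; exacts [le_rfl, hX _]
  have hN := key N le_rfl
  have hHN := H N le_rfl
  rw [Finset.sum_range_succ, Finset.sum_range_succ] at htot
  have := hS N
  have := hS (N + 1)
  have := hYsum N
  have := hX N
  have := hY N
  rw [if_neg (lt_irrefl N)] at hHN
  have hY0 : ∑ i ∈ Finset.range N, Y i = 0 := by linarith
  have hY' : ∀ u < N, Y u = 0 := fun u hu =>
    (Finset.sum_eq_zero_iff_of_nonneg fun i _ => hY i).1 hY0 u (Finset.mem_range.2 hu)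
  refine ⟨by linarith, by linarith, fun u hu => ?_, by linarith, fun u hu => ?_⟩
  · rcases hu.lt_or_eq with hu | rfl
    · exact hY' u hu
    · linarith
  · have := key (u + 1) hu
    rw [Finset.sum_eq_zero (s := Finset.range (u + 1)) (f := Y)
      fun i hi => hY' i (by rw [Finset.mem_range] at hi; omega)] at this
    simp at this
    linarith

/-- The flow with given multiplicities out of the source. -/
def flowOfMultiplicities {N k : ℕ} (f : Fin N → Fin k → ℕ) : PSkEdge (N + 1) k → ℕ :=
  Sum.elim (fun i => (∑ j : Fin N with j.val < (i : ℕ) + 1, ∑ c, f j c) - (i + 1))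
    (Sum.elim (fun _ => 0) fun e => if h : (e.2 : ℕ) < N then f ⟨e.2, h⟩ e.1 else 0)

lemma pathFlow_flowOfMultiplicities {N k : ℕ} (f : Fin N → Fin k → ℕ) (hf : IsDominant f)
    {u : ℕ} (hu : u ≤ N) : pathFlow (flowOfMultiplicities f) u =
      if u = N then 0 else ∑ i ∈ Finset.range (u + 1), extendZero (fun i => ∑ c, f i c) i -
        (u + 1) := by
  rw [pathFlow, extendZero_of_lt _ (by omega)]
  simp only [flowOfMultiplicities, Sum.elim_inl]
  split_ifs with h
  · subst h
    have : ∑ j : Fin u with j.val < u + 1, ∑ c, f j c = u := by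
      rw [Finset.filter_true_of_mem fun i _ => by omega, hf.1]
    rw [this]
    simp
  · rw [sum_range_extendZero _ _ (by omega), Nat.cast_sub (hf.2 _ (by omega))]
    simp

lemma sinkFlow_flowOfMultiplicities {N k : ℕ} (f : Fin N → Fin k → ℕ) (u : ℕ) :
    sinkFlow (flowOfMultiplicities f) u = 0 := by
  simp [sinkFlow, extendZero, flowOfMultiplicities]

lemma sourceFlow_flowOfMultiplicities {N k : ℕ} (f : Fin N → Fin k → ℕ) (u : ℕ) :
    sourceFlow (flowOfMultiplicities f) u = extendZero (fun i => ∑ c, f i c) u := by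
  rcases lt_or_ge u N with h | h
  · rw [sourceFlow, extendZero_of_lt _ (by omega), extendZero_of_lt _ h]
    simp [flowOfMultiplicities, h]
  · rw [extendZero_of_le _ h, sourceFlow, extendZero]
    simp [flowOfMultiplicities, h]

lemma kostant_eq_card_dominant (N k : ℕ) :
    kostant (psSrc (N + 1) k) (psTgt (N + 1) k) (N + 1 + 1) (psFlow (N + 1)) =
      Nat.card {f : Fin N → Fin k → ℕ // IsDominant f} := by
  rw [kostant]
  simp only [isFlow_iff]
  have facts {b : PSkEdge (N + 1) k → ℕ} (hb : _ ∧ _) := flow_eq_of_conservation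
    (N := N) (X := pathFlow b) (Y := sinkFlow b) (S := sourceFlow b)
    (extendZero_nonneg _) (extendZero_nonneg _) (extendZero_nonneg _) hb.1 hb.2
  let restr (b : PSkEdge (N + 1) k → ℕ) (i : Fin N) (c : Fin k) : ℕ :=
    b (.inr (.inr (c, ⟨i, by omega⟩)))
  have hrestr (b) (j : ℕ) (hj : j ≤ N) : ∑ u ∈ Finset.range j, sourceFlow b u =
      ((∑ i : Fin N with i.val < j, ∑ c, restr b i c : ℕ) : ℤ) := by
    rw [← sum_range_extendZero _ _ hj]
    refine Finset.sum_congr rfl fun u hu => ?_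
    rw [Finset.mem_range] at hu
    rw [sourceFlow, extendZero_of_lt _ (by omega), extendZero_of_lt _ (by omega)]
  refine Nat.card_congr (Equiv.ofBijective (fun b => ⟨restr b.1, ?_, ?_⟩) ⟨?_, ?_⟩)
  · obtain ⟨h₁, h₂, -⟩ := facts b.2
    have htot := b.2.1
    rw [Finset.sum_range_succ, Finset.sum_range_succ, h₁, h₂, hrestr _ _ le_rfl,
      Finset.filter_true_of_mem fun i _ => i.2] at htot
    simpa using mod_cast htot
  · intro j hj
    obtain ⟨-, -, -, -, h⟩ := facts b.2
    rcases j with _ | j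
    · simp
    · have h₁ := h j hj
      rw [hrestr _ _ hj] at h₁
      have : 0 ≤ pathFlow b.1 j := extendZero_nonneg _ _
      omega
  · rintro ⟨b, hb⟩ ⟨b', hb'⟩ h
    have hr : restr b = restr b' := Subtype.ext_iff.1 h
    obtain ⟨h₁, h₂, h₃, h₄, h₅⟩ := facts hb
    obtain ⟨h₁', h₂', h₃', h₄', h₅'⟩ := facts hb'
    have hlast (b : PSkEdge (N + 1) k → ℕ) (hN : sourceFlow b N = 0)
        (hN' : sourceFlow b (N + 1) = 0) (c : Fin k) (i : Fin (N + 2)) (hi : N ≤ i) :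
        b (.inr (.inr (c, i))) = 0 := by
      have hs : sourceFlow b i = 0 := by
        obtain hi' | hi' : (i : ℕ) = N ∨ (i : ℕ) = N + 1 := by omega
        · rwa [hi']
        · rwa [hi']
      rw [sourceFlow, extendZero_val (fun i => ∑ c, b (.inr (.inr (c, i))))] at hs
      exact Finset.sum_eq_zero_iff.1 (mod_cast hs) c (Finset.mem_univ c)
    ext1
    funext e
    rcases e with i | i | ⟨c, i⟩
    · have hp : pathFlow b i = pathFlow b' i := by
        rcases (Nat.lt_succ_iff.1 i.2).lt_or_eq with hi | hi
        · rw [h₅ _ hi, h₅' _ hi, hrestr _ _ hi, hrestr _ _ hi, hr]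
        · rw [hi, h₄, h₄']
      rw [pathFlow, pathFlow, extendZero_val (fun i => b (.inl i)),
        extendZero_val (fun i => b' (.inl i))] at hp
      exact mod_cast hp
    · have hy := h₃ i (by omega)
      have hy' := h₃' i (by omega)
      rw [sinkFlow, extendZero_val (fun i => b (.inr (.inl i)))] at hy
      rw [sinkFlow, extendZero_val (fun i => b' (.inr (.inl i)))] at hy'
      exact mod_cast hy.trans hy'.symm
    · rcases lt_or_ge (i : ℕ) N with hi | hi
      · exact congr_fun (congr_fun hr ⟨i, hi⟩) c
      · exact (hlast b h₁ h₂ c i hi).trans (hlast b' h₁' h₂' c i hi).symm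
  · rintro ⟨f, hf⟩
    have htot : ∑ i ∈ Finset.range N, extendZero (fun i => ∑ c, f i c) i = N := by
      rw [sum_range_extendZero _ _ le_rfl, Finset.filter_true_of_mem fun i _ => i.2, hf.1]
    refine ⟨⟨flowOfMultiplicities f, ?_, fun u hu => ?_⟩, ?_⟩
    · simp only [sourceFlow_flowOfMultiplicities]
      rw [Finset.sum_range_succ, Finset.sum_range_succ, htot, extendZero_of_le _ le_rfl,
        extendZero_of_le _ (Nat.le_succ N)]
      simp
    · rw [sinkFlow_flowOfMultiplicities, sourceFlow_flowOfMultiplicities,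
        pathFlow_flowOfMultiplicities f hf hu]
      rcases u with _ | u
      · rcases hu.lt_or_eq with hN | rfl
        · simp [hN, hN.ne]
        · simp [extendZero]
      · rw [pathFlow_flowOfMultiplicities f hf (by omega)]
        rcases hu.lt_or_eq with hN | rfl
        · simp [hN, hN.ne, show u ≠ N by omega, Finset.sum_range_succ]
          ring
        · rw [Nat.add_sub_cancel, htot, extendZero_of_le _ le_rfl]
          simp
    · ext i c
      simp [restr, flowOfMultiplicities]

theorem stmt2 (n k : ℕ) (hn : 2 ≤ n) (hk : 1 ≤ k) :
    kostant (psSrc n k) (psTgt n k) (n + 1) (psFlow n)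
      = Nat.card { w : List (Option ℕ) // IsLDWord (n - 1) k w ∧ w.count (some 0) = 0 } := by
  obtain ⟨N, rfl⟩ := Nat.exists_eq_add_of_le' (one_le_two.trans hn)
  exact (kostant_eq_card_dominant N k).trans (card_dominant_eq_card_words N k)
end

section
/- Let n ≥ 1, k ≥ 0, and 0 ≤ i ≤ n be integers, and let a_0, a_1, …, a_k be nonnegative integers with a_0 + a_1 + ⋯ + a_k = n − i. Then (n + 1) · |Dyck_{n,i}(k; a_0, a_1, …, a_k)| = (i + 1) · Π_{j=0}^{k} binom(n + a_j, a_j). -/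
/-- `w` is a `k`-labeled Dyck prefix from `(0,0)` to `(2n-i, i)`: a word in the
letters `U` (= `none`) and `D_0,…,D_k` of length `2n-i` with exactly `n` `U`'s
(hence `n-i` down-steps), every prefix having at least as many `U`'s as `D`'s,
and labels of consecutive down-steps weakly decreasing. -/
def IsLDPrefix (n i k : ℕ) (w : List (Option ℕ)) : Prop :=
  w.length = 2 * n - i ∧ w.count none = n ∧
  (∀ x ∈ w, ∀ j, x = some j → j ≤ k) ∧
  (∀ p : List (Option ℕ), p <+: w → p.length ≤ 2 * p.count none) ∧
  w.Chain' DownWeak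

theorem List.length_eq_count_none_add_sum {K : ℕ} {w : List (Option ℕ)}
    (h : ∀ j, K ≤ j → w.count (some j) = 0) :
    w.length = w.count none + ∑ j ∈ Finset.range K, w.count (some j) := by
  have key : ∑ x ∈ Finset.insertNone (Finset.range K), (w : Multiset (Option ℕ)).count x = w.length := by
    refine Multiset.sum_count_eq_card fun x hx => ?_
    cases x with
    | none => simp
    | some j =>
      have hj : j < K := by
        by_contra hj
        exact List.count_eq_zero.mp (h j (not_lt.mp hj)) (by simpa using hx)
      simpa using hj
  rw [Finset.sum_insertNone] at key
  convert key.symm using 1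
  simp only [Multiset.coe_count]
  congr!

/-- Reversals of labeled Dyck prefixes with `n` up-steps and `a j` down-steps labeled `j`,
whose final down-steps all have labels at least `t`. -/
def reversedPrefixes (n : ℕ) (a : ℕ → ℕ) (t : ℕ) : Set (List (Option ℕ)) :=
  {w | (∀ s, s <:+ w → s.length ≤ 2 * s.count none) ∧ w.IsChain (fun x y => DownWeak y x) ∧
    w.count none = n ∧ (∀ j, w.count (some j) = a j) ∧ ∀ j, w.head? = some (some j) → t ≤ j}

/-- The closed form for the number of `reversedPrefixes (n + 1) a t`, where all labels are below
`K`; at `t = K` it also counts `reversedPrefixes n a 0`. -/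
def prefixWeight (K n t : ℕ) (a : ℕ → ℕ) : ℚ :=
  (∏ j ∈ Finset.range K, ((n + (if t ≤ j then 1 else 0) + a j).choose (a j) : ℚ)) *
    (1 - ∑ j ∈ Finset.range K, (a j : ℚ) / (n + 1 + (if t ≤ j then 1 else 0)))

theorem prefixWeight_succ_label {K n t : ℕ} {a : ℕ → ℕ} (hat : a t = 0) :
    prefixWeight K n (t + 1) a = prefixWeight K n t a := by
  unfold prefixWeight
  congr 1
  · refine Finset.prod_congr rfl fun j _ => ?_
    rcases eq_or_ne j t with rfl | hj
    · simp [hat]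
    · simp only [show t + 1 ≤ j ↔ t ≤ j by omega]
  · congr 1
    refine Finset.sum_congr rfl fun j _ => ?_
    rcases eq_or_ne j t with rfl | hj
    · simp [hat]
    · simp only [show t + 1 ≤ j ↔ t ≤ j by omega]

theorem choose_weight_recurrence (n b : ℕ) (L : ℚ) :
    ((n + 1 + (b + 1)).choose (b + 1) : ℚ) * (L - (b + 1) / (n + 2)) =
      ((n + (b + 1)).choose (b + 1) : ℚ) * (L - (b + 1) / (n + 1)) +
        ((n + 1 + b).choose b : ℚ) * (L - b / (n + 2)) := by
  have pascal : ((n + 1 + (b + 1)).choose (b + 1) : ℚ) =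
      ((n + 1 + b).choose b : ℚ) + ((n + (b + 1)).choose (b + 1) : ℚ) := by
    have := Nat.choose_succ_succ (n + 1 + b) b
    rw [show n + (b + 1) = n + 1 + b by ring]
    exact_mod_cast this
  have absorb : ((n + (b + 1)).choose (b + 1) : ℚ) * (b + 1) =
      ((n + 1 + b).choose b : ℚ) * (n + 1) := by
    have := Nat.choose_succ_right_eq (n + 1 + b) b
    rw [show n + 1 + b - b = n + 1 by omega] at this
    rw [show n + (b + 1) = n + 1 + b by ring]
    exact_mod_cast this
  have h1 : (n : ℚ) + 1 ≠ 0 := by positivity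
  have h2 : (n : ℚ) + 2 ≠ 0 := by positivity
  rw [pascal]
  field_simp
  linear_combination ((n : ℚ) + 1) * absorb * (-1) + (n + 2) * absorb

theorem prefixWeight_eq_add {K n t b : ℕ} {a : ℕ → ℕ} (ht : t < K) (hat : a t = b + 1) :
    prefixWeight K n t a =
      prefixWeight K n (t + 1) a + prefixWeight K n t (Function.update a t b) := by
  have htK : t ∈ Finset.range K := Finset.mem_range.mpr ht
  have hP1 : ∏ j ∈ (Finset.range K).erase t,
      ((n + (if t + 1 ≤ j then 1 else 0) + a j).choose (a j) : ℚ) =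
      ∏ j ∈ (Finset.range K).erase t, ((n + (if t ≤ j then 1 else 0) + a j).choose (a j) : ℚ) := by
    refine Finset.prod_congr rfl fun j hj => ?_
    have := Finset.ne_of_mem_erase hj
    simp only [show t + 1 ≤ j ↔ t ≤ j by omega]
  have hP2 : ∏ j ∈ (Finset.range K).erase t, ((n + (if t ≤ j then 1 else 0) +
      Function.update a t b j).choose (Function.update a t b j) : ℚ) =
      ∏ j ∈ (Finset.range K).erase t, ((n + (if t ≤ j then 1 else 0) + a j).choose (a j) : ℚ) := by
    refine Finset.prod_congr rfl fun j hj => ?_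
    rw [Function.update_of_ne (Finset.ne_of_mem_erase hj)]
  have hS1 : ∑ j ∈ (Finset.range K).erase t,
      (a j : ℚ) / (n + 1 + (if t + 1 ≤ j then 1 else 0)) =
      ∑ j ∈ (Finset.range K).erase t, (a j : ℚ) / (n + 1 + (if t ≤ j then 1 else 0)) := by
    refine Finset.sum_congr rfl fun j hj => ?_
    have := Finset.ne_of_mem_erase hj
    simp only [show t + 1 ≤ j ↔ t ≤ j by omega]
  have hS2 : ∑ j ∈ (Finset.range K).erase t,
      (Function.update a t b j : ℚ) / (n + 1 + (if t ≤ j then 1 else 0)) =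
      ∑ j ∈ (Finset.range K).erase t, (a j : ℚ) / (n + 1 + (if t ≤ j then 1 else 0)) := by
    refine Finset.sum_congr rfl fun j hj => ?_
    rw [Function.update_of_ne (Finset.ne_of_mem_erase hj)]
  unfold prefixWeight
  simp only [← Finset.mul_prod_erase _ _ htK, ← Finset.add_sum_erase _ _ htK, hP1, hP2, hS1, hS2]
  simp only [le_refl, if_true, Function.update_self, hat, show ¬ t + 1 ≤ t by omega, if_false]
  generalize ∏ j ∈ (Finset.range K).erase t,
    ((n + (if t ≤ j then 1 else 0) + a j).choose (a j) : ℚ) = P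
  generalize ∑ j ∈ (Finset.range K).erase t, (a j : ℚ) / (n + 1 + (if t ≤ j then 1 else 0)) = S
  have key := choose_weight_recurrence n b (1 - S)
  push_cast
  rw [add_zero, add_zero, show (n : ℚ) + 1 + 1 = n + 2 by ring]
  linear_combination P * key

theorem prefixWeight_zero_label (K n : ℕ) (a : ℕ → ℕ) :
    prefixWeight K n 0 a = prefixWeight K (n + 1) K a := by
  unfold prefixWeight
  congr 1
  · refine Finset.prod_congr rfl fun j hj => ?_
    simp [not_le.mpr (Finset.mem_range.mp hj)]
  · congr 1
    refine Finset.sum_congr rfl fun j hj => ?_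
    simp [not_le.mpr (Finset.mem_range.mp hj)]

theorem prefixWeight_top_label (K n : ℕ) (a : ℕ → ℕ) :
    prefixWeight K n K a = (∏ j ∈ Finset.range K, ((n + a j).choose (a j) : ℚ)) *
      (1 - (∑ j ∈ Finset.range K, a j : ℕ) / (n + 1)) := by
  unfold prefixWeight
  congr 1
  · refine Finset.prod_congr rfl fun j hj => ?_
    simp [not_le.mpr (Finset.mem_range.mp hj)]
  · rw [Nat.cast_sum, Finset.sum_div]
    congr 1
    refine Finset.sum_congr rfl fun j hj => ?_
    simp [not_le.mpr (Finset.mem_range.mp hj)]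

theorem reversedPrefixes_succ_label {n t : ℕ} {a : ℕ → ℕ} (hat : a t = 0) :
    reversedPrefixes n a t = reversedPrefixes n a (t + 1) := by
  ext w
  simp only [reversedPrefixes, Set.mem_ofPred_eq]
  refine and_congr_right fun _ => and_congr_right fun _ => and_congr_right fun _ =>
    and_congr_right fun hc => forall_congr' fun j => ?_
  constructor
  · intro h hj
    have hne : j ≠ t := by
      rintro rfl
      exact List.count_eq_zero.mp ((hc j).trans hat) (List.mem_of_mem_head? hj)
    have := h hj
    omega
  · intro h hj
    have := h hj
    omega

theorem suffixes_cons_iff {x : Option ℕ} {w : List (Option ℕ)} :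
    (∀ s, s <:+ x :: w → s.length ≤ 2 * s.count none) ↔
      (x :: w).length ≤ 2 * (x :: w).count none ∧
        ∀ s, s <:+ w → s.length ≤ 2 * s.count none := by
  simp only [List.suffix_cons_iff, or_imp, forall_and, forall_eq]

theorem isChain_cons_some_iff {t : ℕ} {w : List (Option ℕ)} :
    (some t :: w).IsChain (fun x y => DownWeak y x) ↔
      w.IsChain (fun x y => DownWeak y x) ∧ ∀ j, w.head? = some (some j) → t ≤ j := by
  rw [List.isChain_cons, and_comm]
  refine and_congr_right fun _ => ⟨fun h j hj => h _ hj _ _ rfl rfl, ?_⟩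
  rintro h y hy p q rfl hq
  obtain rfl := Option.some.inj hq
  exact h p hy

theorem isChain_cons_none_iff {w : List (Option ℕ)} :
    (none :: w).IsChain (fun x y => DownWeak y x) ↔ w.IsChain (fun x y => DownWeak y x) := by
  rw [List.isChain_cons, and_iff_right_iff_imp]
  rintro _ y _ p q _ hq
  cases hq

theorem length_of_mem_reversedPrefixes {K n t : ℕ} {a : ℕ → ℕ} (haK : ∀ j, K ≤ j → a j = 0)
    {w : List (Option ℕ)} (hw : w ∈ reversedPrefixes n a t) :
    w.length = n + ∑ j ∈ Finset.range K, a j := by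
  obtain ⟨_, _, hn, hc, _⟩ := hw
  rw [List.length_eq_count_none_add_sum (K := K) fun j hj => (hc j).trans (haK j hj), hn]
  simp only [hc]

theorem cons_some_mem_reversedPrefixes_iff {n t b : ℕ} {a : ℕ → ℕ} (hat : a t = b + 1)
    {w : List (Option ℕ)} :
    some t :: w ∈ reversedPrefixes n a t ↔
      w.length + 1 ≤ 2 * n ∧ w ∈ reversedPrefixes n (Function.update a t b) t := by
  simp only [reversedPrefixes, Set.mem_ofPred_eq, suffixes_cons_iff, isChain_cons_some_iff,
    List.length_cons, List.head?_cons]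
  have hnone : (some t :: w).count none = w.count none := by simp
  have hcount : (∀ j, (some t :: w).count (some j) = a j) ↔
      ∀ j, w.count (some j) = Function.update a t b j := by
    refine forall_congr' fun j => ?_
    rcases eq_or_ne j t with rfl | hj
    · simp [hat]
    · rw [Function.update_of_ne hj, List.count_cons_of_ne (by simpa using hj.symm)]
  rw [hnone, hcount]
  constructor
  · rintro ⟨⟨h1, h2⟩, ⟨h3, h4⟩, rfl, h5, -⟩
    exact ⟨h1, h2, h3, rfl, h5, h4⟩
  · rintro ⟨h1, h2, h3, rfl, h5, h4⟩
    exact ⟨⟨h1, h2⟩, ⟨h3, h4⟩, rfl, h5, fun j hj => by simp_all⟩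

theorem reversedPrefixes_eq_union {K n t b : ℕ} {a : ℕ → ℕ} (haK : ∀ j, K ≤ j → a j = 0)
    (han : ∑ j ∈ Finset.range K, a j ≤ n) (hat : a t = b + 1) :
    reversedPrefixes n a t = reversedPrefixes n a (t + 1) ∪
      List.cons (some t) '' reversedPrefixes n (Function.update a t b) t := by
  have ht : t < K := by
    by_contra ht
    have := haK t (not_lt.mp ht)
    omega
  have hsum : ∑ j ∈ Finset.range K, Function.update a t b j + 1 = ∑ j ∈ Finset.range K, a j := by
    have htK : t ∈ Finset.range K := Finset.mem_range.mpr ht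
    rw [Finset.sum_update_of_mem htK, ← Finset.add_sum_erase _ _ htK, hat, Finset.erase_eq]
    ring
  ext w
  constructor
  · intro hw
    by_cases hh : w.head? = some (some t)
    · obtain ⟨v, rfl⟩ := List.head?_eq_some_iff.mp hh
      exact Or.inr ⟨v, ((cons_some_mem_reversedPrefixes_iff hat).mp hw).2, rfl⟩
    · obtain ⟨h1, h2, h3, h4, h5⟩ := hw
      refine Or.inl ⟨h1, h2, h3, h4, fun j hj => ?_⟩
      exact Nat.lt_of_le_of_ne (h5 j hj) fun h => hh (h ▸ hj)
  · rintro (⟨h1, h2, h3, h4, h5⟩ | ⟨v, hv, rfl⟩)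
    · exact ⟨h1, h2, h3, h4, fun j hj => (Nat.le_succ t).trans (h5 j hj)⟩
    · refine (cons_some_mem_reversedPrefixes_iff hat).mpr ⟨?_, hv⟩
      have hK : ∀ j, K ≤ j → Function.update a t b j = 0 := fun j hj => by
        rw [Function.update_of_ne (by omega), haK j hj]
      have := length_of_mem_reversedPrefixes hK hv
      omega

theorem reversedPrefixes_succ_top {K n : ℕ} {a : ℕ → ℕ} (haK : ∀ j, K ≤ j → a j = 0)
    (han : ∑ j ∈ Finset.range K, a j ≤ n + 1) :
    reversedPrefixes (n + 1) a K = List.cons none '' reversedPrefixes n a 0 := by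
  ext w
  constructor
  · rintro ⟨h1, h2, h3, h4, h5⟩
    match w with
    | [] => simp at h3
    | some j :: v =>
      have h0 := (h4 j).trans (haK j (h5 j rfl))
      simp at h0
    | none :: v =>
      refine ⟨v, ⟨(suffixes_cons_iff.mp h1).2, isChain_cons_none_iff.mp h2, by simpa using h3,
        fun j => ?_, fun _ _ => Nat.zero_le _⟩, rfl⟩
      simpa using h4 j
  · rintro ⟨v, hv, rfl⟩
    have hl := length_of_mem_reversedPrefixes haK hv
    obtain ⟨h1, h2, h3, h4, -⟩ := hv
    refine ⟨suffixes_cons_iff.mpr ⟨?_, h1⟩, isChain_cons_none_iff.mpr h2, by simpa using h3,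
      fun j => ?_, fun j hj => by simp at hj⟩
    · simp only [List.length_cons, List.count_cons_self]
      omega
    · simpa using h4 j

theorem reversedPrefixes_eq_empty {K n t : ℕ} {a : ℕ → ℕ} (haK : ∀ j, K ≤ j → a j = 0)
    (han : n < ∑ j ∈ Finset.range K, a j) : reversedPrefixes n a t = ∅ := by
  refine Set.eq_empty_of_forall_notMem fun w hw => ?_
  have hl := length_of_mem_reversedPrefixes haK hw
  have := hw.1 w List.suffix_rfl
  rw [hw.2.2.1] at this
  omega

theorem reversedPrefixes_zero_zero : reversedPrefixes 0 0 0 = {[]} := by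
  ext w
  rw [Set.mem_singleton_iff]
  constructor
  · intro hw
    have hl := length_of_mem_reversedPrefixes (K := 0) (fun _ _ => rfl) hw
    simpa using hl
  · rintro rfl
    simp [reversedPrefixes]

theorem ncard_reversedPrefixes_succ {K n : ℕ}
    (base : ∀ a : ℕ → ℕ, (∀ j, K ≤ j → a j = 0) → ∑ j ∈ Finset.range K, a j ≤ n + 1 →
      (reversedPrefixes n a 0).Finite ∧
        ((reversedPrefixes n a 0).ncard : ℚ) = prefixWeight K n K a)
    {t : ℕ} (ht : t ≤ K) : ∀ a : ℕ → ℕ, (∀ j, K ≤ j → a j = 0) →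
      ∑ j ∈ Finset.range K, a j ≤ n + 1 → (reversedPrefixes (n + 1) a t).Finite ∧
        ((reversedPrefixes (n + 1) a t).ncard : ℚ) = prefixWeight K n t a := by
  induction ht using Nat.decreasingInduction with
  | self =>
    intro a haK han
    obtain ⟨hf, hc⟩ := base a haK han
    rw [reversedPrefixes_succ_top haK han, Set.ncard_image_of_injective _ List.cons_injective]
    exact ⟨hf.image _, hc⟩
  | of_succ t ht ih =>
    intro a haK han
    generalize hat : a t = b
    induction b generalizing a with
    | zero =>
      rw [reversedPrefixes_succ_label hat, ← prefixWeight_succ_label hat]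
      exact ih a haK han
    | succ b ihb =>
      have hK : ∀ j, K ≤ j → Function.update a t b j = 0 := fun j hj => by
        rw [Function.update_of_ne (by omega), haK j hj]
      have hsum : ∑ j ∈ Finset.range K, Function.update a t b j ≤ n + 1 := by
        refine (Finset.sum_le_sum fun j _ => ?_).trans han
        rcases eq_or_ne j t with rfl | hj
        · simp [hat]
        · simp [hj]
      obtain ⟨hf1, hc1⟩ := ih a haK han
      obtain ⟨hf2, hc2⟩ := ihb _ hK hsum (Function.update_self ..)
      have hdisj : Disjoint (reversedPrefixes (n + 1) a (t + 1))
          (List.cons (some t) '' reversedPrefixes (n + 1) (Function.update a t b) t) := by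
        rw [Set.disjoint_left]
        rintro _ hw ⟨v, _, rfl⟩
        have := hw.2.2.2.2 t rfl
        omega
      rw [reversedPrefixes_eq_union haK han hat]
      refine ⟨hf1.union (hf2.image _), ?_⟩
      rw [Set.ncard_union_eq hdisj hf1 (hf2.image _),
        Set.ncard_image_of_injective _ List.cons_injective, Nat.cast_add, hc1, hc2,
        prefixWeight_eq_add ht hat]

theorem ncard_reversedPrefixes (K n : ℕ) : ∀ a : ℕ → ℕ, (∀ j, K ≤ j → a j = 0) →
    ∑ j ∈ Finset.range K, a j ≤ n + 1 → (reversedPrefixes n a 0).Finite ∧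
      ((reversedPrefixes n a 0).ncard : ℚ) = prefixWeight K n K a := by
  have boundary : ∀ n a, (∀ j, K ≤ j → a j = 0) → ∑ j ∈ Finset.range K, a j = n + 1 →
      (reversedPrefixes n a 0).Finite ∧
        ((reversedPrefixes n a 0).ncard : ℚ) = prefixWeight K n K a := by
    intro n a haK han
    rw [reversedPrefixes_eq_empty haK (by omega), prefixWeight_top_label, han]
    have : (n : ℚ) + 1 ≠ 0 := by positivity
    simp [this]
  induction n with
  | zero =>
    intro a haK han
    rcases han.eq_or_lt with h | h
    · exact boundary 0 a haK h
    · have ha : a = 0 := by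
        funext j
        by_cases hj : K ≤ j
        · exact haK j hj
        · exact Finset.sum_eq_zero_iff.mp (by omega) j (Finset.mem_range.mpr (not_le.mp hj))
      subst ha
      rw [reversedPrefixes_zero_zero, prefixWeight_top_label]
      simp
  | succ n ih =>
    intro a haK han
    rcases han.eq_or_lt with h | h
    · exact boundary (n + 1) a haK h
    · rw [← prefixWeight_zero_label]
      exact ncard_reversedPrefixes_succ ih (Nat.zero_le K) a haK (by omega)

theorem reverse_mem_reversedPrefixes_iff {n i k : ℕ} (hi : i ≤ n) {a : Fin (k + 1) → ℕ}
    (ha : ∑ j, a j = n - i) {w : List (Option ℕ)} :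
    w.reverse ∈ reversedPrefixes n (fun j => if h : j < k + 1 then a ⟨j, h⟩ else 0) 0 ↔
      IsLDPrefix n i k w ∧ ∀ j : Fin (k + 1), w.count (some (j : ℕ)) = a j := by
  have hpre : (∀ s, s <:+ w.reverse → s.length ≤ 2 * s.count none) ↔
      ∀ p : List (Option ℕ), p <+: w → p.length ≤ 2 * p.count none := by
    constructor
    · intro h p hp
      simpa using h p.reverse (List.reverse_suffix.mpr hp)
    · intro h s hs
      simpa using h s.reverse (by rwa [← List.reverse_suffix, List.reverse_reverse])
  simp only [reversedPrefixes, Set.mem_ofPred_eq, hpre, List.isChain_reverse, List.count_reverse,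
    Nat.zero_le, implies_true, and_true, IsLDPrefix]
  constructor
  · rintro ⟨h1, h2, h3, h4⟩
    have hz : ∀ j, k + 1 ≤ j → w.count (some j) = 0 := fun j hj => by
      rw [h4, dif_neg (by omega)]
    refine ⟨⟨?_, h3, ?_, h1, h2⟩, fun j => by rw [h4, dif_pos j.is_lt]⟩
    · rw [List.length_eq_count_none_add_sum hz, h3, Finset.sum_range]
      simp only [h4, Fin.is_lt, dite_true, Fin.eta, ha]
      omega
    · rintro _ hx j rfl
      by_contra hj
      exact List.count_eq_zero.mp (hz j (by omega)) hx
  · rintro ⟨⟨_, h3, h5, h1, h2⟩, h4⟩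
    refine ⟨h1, h2, h3, fun j => ?_⟩
    split_ifs with hj
    · exact h4 ⟨j, hj⟩
    · refine List.count_eq_zero.mpr fun hx => ?_
      have := h5 _ hx j rfl
      omega

theorem stmt10 (n i k : ℕ) (hn : 1 ≤ n) (hi : i ≤ n) (a : Fin (k + 1) → ℕ)
    (ha : ∑ j, a j = n - i) :
    (n + 1) * Nat.card { w : List (Option ℕ) // IsLDPrefix n i k w ∧
        ∀ j : Fin (k + 1), w.count (some (j : ℕ)) = a j }
      = (i + 1) * ∏ j : Fin (k + 1), Nat.choose (n + a j) (a j) := by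
  set A : ℕ → ℕ := fun j => if h : j < k + 1 then a ⟨j, h⟩ else 0 with hA
  have hsum : ∑ j ∈ Finset.range (k + 1), A j = n - i := by
    rw [Finset.sum_range, ← ha]
    simp only [hA, Fin.is_lt, dite_true, Fin.eta]
  have hprod : ∏ j ∈ Finset.range (k + 1), ((n + A j).choose (A j) : ℚ) =
      ∏ j : Fin (k + 1), ((n + a j).choose (a j) : ℚ) := by
    rw [Finset.prod_range]
    simp only [hA, Fin.is_lt, dite_true, Fin.eta]
  have hcard : Nat.card { w : List (Option ℕ) // IsLDPrefix n i k w ∧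
      ∀ j : Fin (k + 1), w.count (some (j : ℕ)) = a j } = (reversedPrefixes n A 0).ncard :=
    Nat.card_congr ((List.reverse_involutive.toPerm _).subtypeEquiv fun _ =>
      (reverse_mem_reversedPrefixes_iff hi ha).symm)
  have hcount := (ncard_reversedPrefixes (k + 1) n A (fun j hj => dif_neg (by omega))
    (by omega)).2
  rw [prefixWeight_top_label, hsum, hprod, Nat.cast_sub hi] at hcount
  have hn0 : (n : ℚ) + 1 ≠ 0 := by positivity
  rw [hcard]
  qify
  rw [hcount]
  field_simp
  ring
end
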